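/- Let (Y,θ) be a generating system of k nondegenerate regular A-correspondences, write O = O_{Y_1}, ℰY_i = Y_i ⊗_A O, ℛθ_{ij} = ν_{ji}^{-1}(θ_{ij}⊗1_O)ν_{ij}, and let ξ = ν_{ℓ(i⊗j)}(1_{Y_ℓ⊗O} ⊗ ν_{ij}) and ν = ν_{(j⊗ℓ)i}(ν_{jℓ} ⊗ 1_{Y_i⊗O}) be the triple absorption isomorphisms. Then for all ℓ,i,j: (1) (ℛθ_{ℓj} ⊗ 1_{ℰY_i})(1_{ℰY_ℓ} ⊗ ℛθ_{ij}) = ξ^{-1}(θ_{ℓj}⊗1_{Y_i}⊗1_O)(1_{Y_ℓ}⊗θ_{ij}⊗1_O)ν; and (2) (1_{ℰY_j} ⊗ ℛθ_{iℓ})(ℛθ_{ij} ⊗ 1_{ℰY_ℓ})(1_{ℰY_i} ⊗ ℛθ_{ℓj})(ℛθ_{ℓi} ⊗ 1_{ℰY_j}) = ξ^{-1}((1_{Y_j}⊗θ_{iℓ})(θ_{ij}⊗1_{Y_ℓ})(1_{Y_i}⊗θ_{ℓj})(θ_{ℓi}⊗1_{Y_j}) ⊗ 1_O)ν. -/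

import Mathlib

/- ############################################################
   Common framework: C*-correspondences, interior tensor products
   (characterized relationally), representations, Cuntz–Pimsner algebras,
   product systems over ℕ^k, generating systems, and the ℰ / ℛθ
   constructions of the paper (characterized relationally).
   ############################################################ -/

noncomputable section

open Filter Topology

universe u

/-- A C*-correspondence over a (not necessarily unital) C*-algebra `A`:
a right Hilbert `A`-module `X` together with a left action of `A` by
adjointable (bounded) operators.  The rank-one operators `θ_{x,y}` are
bundled as data together with their defining property. -/
structure Corr (A : Type u) [NonUnitalCStarAlgebra A] : Type (u + 1) where
  X : Type u
  [nacg : NormedAddCommGroup X]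
  [nsp : NormedSpace ℂ X]
  [cmpl : CompleteSpace X]
  /-- right action of `A` -/
  ract : X → A → X
  /-- `A`-valued inner product -/
  inner : X → X → A
  /-- left action `φ : A → L(X)` by adjointable operators -/
  lactL : A → X →L[ℂ] X
  /-- the rank-one ("compact") operators `θ_{x,y} z = x ⬝ ⟨y, z⟩` -/
  rankOne : X → X → X →L[ℂ] X
  ract_add_left : ∀ x y a, ract (x + y) a = ract x a + ract y a
  ract_add_right : ∀ x a b, ract x (a + b) = ract x a + ract x b
  ract_mul : ∀ x a b, ract x (a * b) = ract (ract x a) b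
  ract_smul : ∀ (c : ℂ) x a, ract (c • x) a = c • ract x a
  ract_smul' : ∀ (c : ℂ) x a, ract x (c • a) = c • ract x a
  inner_add_right : ∀ x y z, inner x (y + z) = inner x y + inner x z
  inner_smul_right : ∀ (c : ℂ) x y, inner x (c • y) = c • inner x y
  inner_star : ∀ x y, star (inner x y) = inner y x
  inner_ract_right : ∀ x y a, inner x (ract y a) = inner x y * a
  norm_eq : ∀ x, ‖x‖ ^ 2 = ‖inner x x‖
  lact_add : ∀ a b, lactL (a + b) = lactL a + lactL b
  lact_mul : ∀ a b, lactL (a * b) = (lactL a).comp (lactL b)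
  lact_smul : ∀ (c : ℂ) a, lactL (c • a) = c • lactL a
  lact_adjoint : ∀ a x y, inner (lactL a x) y = inner x (lactL (star a) y)
  rankOne_apply : ∀ x y z, rankOne x y z = ract x (inner y z)

attribute [instance] Corr.nacg Corr.nsp Corr.cmpl

variable {A : Type u} [NonUnitalCStarAlgebra A]

/-- Nondegeneracy: `A·X` is (topologically) all of `X`. -/
def Corr.Nondeg (W : Corr A) : Prop :=
  closure (Submodule.span ℂ {y : W.X | ∃ a x, y = W.lactL a x} : Set W.X) = Set.univ

/-- Regularity: the left action is injective and takes values in the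
compact operators (the closed span of the rank-one operators). -/
def Corr.Regular (W : Corr A) : Prop :=
  (∀ a, W.lactL a = 0 → a = 0) ∧
    ∀ a, W.lactL a ∈
      closure (Submodule.span ℂ {T : W.X →L[ℂ] W.X | ∃ x y, T = W.rankOne x y} :
        Set (W.X →L[ℂ] W.X))

/-- standing hypotheses of the paper: nondegenerate and regular -/
def Corr.Reg (W : Corr A) : Prop := W.Nondeg ∧ W.Regular

/-- a bare function which is a continuous `ℂ`-linear map -/
structure IsCLMap {E F : Type u} [NormedAddCommGroup E] [NormedSpace ℂ E]
    [NormedAddCommGroup F] [NormedSpace ℂ F] (f : E → F) : Prop where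
  map_add : ∀ x y, f (x + y) = f x + f y
  map_smul : ∀ (c : ℂ) x, f (c • x) = c • f x
  cont : Continuous f

/-- a map of correspondences over the same algebra which is an isomorphism -/
structure IsCorrIsoFun (W Z : Corr A) (f : W.X → Z.X) : Prop where
  bijective : Function.Bijective f
  map_add : ∀ x y, f (x + y) = f x + f y
  map_smul : ∀ (c : ℂ) x, f (c • x) = c • f x
  map_inner : ∀ x y, Z.inner (f x) (f y) = W.inner x y
  map_ract : ∀ x a, f (W.ract x a) = Z.ract (f x) a
  map_lact : ∀ a x, f (W.lactL a x) = Z.lactL a (f x)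

/-- an isomorphism of correspondences over the same algebra (bundled) -/
structure CorrIso (W Z : Corr A) : Type u where
  toFun : W.X → Z.X
  invFun : Z.X → W.X
  left_inv : ∀ x, invFun (toFun x) = x
  right_inv : ∀ y, toFun (invFun y) = y
  map_add : ∀ x y, toFun (x + y) = toFun x + toFun y
  map_smul : ∀ (c : ℂ) x, toFun (c • x) = c • toFun x
  map_inner : ∀ x y, Z.inner (toFun x) (toFun y) = W.inner x y
  map_ract : ∀ x a, toFun (W.ract x a) = Z.ract (toFun x) a
  map_lact : ∀ a x, toFun (W.lactL a x) = Z.lactL a (toFun x)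

/-- an isomorphism of correspondences lying over an isomorphism `Φ` of the
coefficient algebras -/
structure CorrIsoOver {B : Type u} [NonUnitalCStarAlgebra B]
    (Φ : A → B) (W : Corr A) (Z : Corr B) : Type u where
  toFun : W.X → Z.X
  bijective : Function.Bijective toFun
  map_add : ∀ x y, toFun (x + y) = toFun x + toFun y
  map_smul : ∀ (c : ℂ) x, toFun (c • x) = c • toFun x
  map_inner : ∀ x y, Z.inner (toFun x) (toFun y) = Φ (W.inner x y)
  map_ract : ∀ x a, toFun (W.ract x a) = Z.ract (toFun x) (Φ a)
  map_lact : ∀ a x, toFun (W.lactL a x) = Z.lactL (Φ a) (toFun x)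

/-- `T`, together with the bilinear map `m`, is a realization of the
balanced (interior) tensor product `W ⊗_A V` of correspondences over `A`. -/
structure IsTensor (W V T : Corr A) (m : W.X → V.X → T.X) : Prop where
  add_left : ∀ x x' y, m (x + x') y = m x y + m x' y
  add_right : ∀ x y y', m x (y + y') = m x y + m x y'
  smul_left : ∀ (c : ℂ) x y, m (c • x) y = c • m x y
  smul_right : ∀ (c : ℂ) x y, m x (c • y) = c • m x y
  balanced : ∀ x a y, m (W.ract x a) y = m x (V.lactL a y)
  inner : ∀ x y x' y',
    T.inner (m x y) (m x' y') = V.inner y (V.lactL (W.inner x x') y')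
  ract : ∀ x y a, T.ract (m x y) a = m x (V.ract y a)
  lact : ∀ a x y, T.lactL a (m x y) = m (W.lactL a x) y
  dense : closure (Submodule.span ℂ {z : T.X | ∃ x y, z = m x y} : Set T.X) = Set.univ

variable {B : Type u} [NonUnitalCStarAlgebra B]

/-- `π : A → B` is a *-homomorphism (stated elementwise) -/
structure IsStarHom (π : A → B) : Prop where
  map_add : ∀ a b, π (a + b) = π a + π b
  map_mul : ∀ a b, π (a * b) = π a * π b
  map_star : ∀ a, π (star a) = star (π a)
  map_smul : ∀ (c : ℂ) a, π (c • a) = c • π a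

/-- `(π, t)` is a representation (Toeplitz representation) of the
correspondence `W` in the C*-algebra `B`. -/
structure IsRep (W : Corr A) (π : A → B) (t : W.X → B) : Prop where
  hom : IsStarHom π
  t_add : ∀ x y, t (x + y) = t x + t y
  t_smul : ∀ (c : ℂ) x, t (c • x) = c • t x
  lact : ∀ a x, t (W.lactL a x) = π a * t x
  ract : ∀ x a, t (W.ract x a) = t x * π a
  inner : ∀ x y, star (t x) * t y = π (W.inner x y)

/-- Cuntz–Pimsner covariance of a representation of a *regular*
correspondence: whenever `φ(a)` is approximated in norm by finite sums of
rank-one operators `θ_{x,y}`, `π(a)` is approximated by the corresponding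
sums `t(x) t(y)*`.  (For regular correspondences this is equivalent to
`π = t⁽¹⁾ ∘ φ`.) -/
def CPCov (W : Corr A) (π : A → B) (t : W.X → B) : Prop :=
  ∀ (a : A) (N : ℕ → ℕ) (x y : ∀ n, Fin (N n) → W.X),
    Tendsto (fun n => ∑ r, W.rankOne (x n r) (y n r)) atTop (𝓝 (W.lactL a)) →
    Tendsto (fun n => ∑ r, t (x n r) * star (t (y n r))) atTop (𝓝 (π a))

/-- The Cuntz–Pimsner algebra of a correspondence `W`: a C*-algebra `O`
together with a universal covariant representation `(π, t)`:  `(π,t)` is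
covariant, `π` is injective, `O` is generated by the images of `π` and `t`,
and every covariant representation factors uniquely through `O`. -/
structure CPAlg (W : Corr A) : Type (u + 1) where
  O : Type u
  [alg : NonUnitalCStarAlgebra O]
  π : A → O
  t : W.X → O
  isRep : IsRep W π t
  covariant : CPCov W π t
  inj : Function.Injective π
  gen : ∀ S : Set O, IsClosed S →
    (∀ a, π a ∈ S) → (∀ x, t x ∈ S) →
    (∀ p q, p ∈ S → q ∈ S → p + q ∈ S) →
    (∀ p q, p ∈ S → q ∈ S → p * q ∈ S) →
    (∀ (c : ℂ) p, p ∈ S → c • p ∈ S) →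
    (∀ p, p ∈ S → star p ∈ S) → ∀ z, z ∈ S
  universal : ∀ (C : Type u) [NonUnitalCStarAlgebra C],
    ∀ (π' : A → C) (t' : W.X → C), IsRep W π' t' → CPCov W π' t' →
      ∃! h : O →⋆ₙₐ[ℂ] C, (∀ a, h (π a) = π' a) ∧ ∀ x, h (t x) = t' x

attribute [instance] CPAlg.alg

/- ##################  product systems over ℕ^k  ################## -/

/-- the `i`-th standard generator of `ℕ^k` -/
def egen {k : ℕ} (i : Fin k) : Fin k → ℕ := Pi.single i 1

/-- A product system over `ℕ^k` of (nondegenerate regular) correspondences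
over `A`:  fibers `fib s`, an associative multiplication implementing
isomorphisms `fib s ⊗_A fib t ≅ fib (s+t)`, and `fib 0 = A` (witnessed by
the unit map). -/
structure PSys (A : Type u) [NonUnitalCStarAlgebra A] (k : ℕ) : Type (u + 1) where
  fib : (Fin k → ℕ) → Corr A
  reg : ∀ s, (fib s).Reg
  mul : ∀ s t, (fib s).X → (fib t).X → (fib (s + t)).X
  isTensor : ∀ s t, IsTensor (fib s) (fib t) (fib (s + t)) (mul s t)
  assoc : ∀ s t u x y z,
    HEq (mul (s + t) u (mul s t x y) z) (mul s (t + u) x (mul t u y z))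
  unit : A → (fib 0).X
  unit_bij : Function.Bijective unit
  unit_add : ∀ a b, unit (a + b) = unit a + unit b
  unit_smul : ∀ (c : ℂ) a, unit (c • a) = c • unit a
  unit_inner : ∀ a b, (fib 0).inner (unit a) (unit b) = star a * b
  unit_lact : ∀ a b, (fib 0).lactL a (unit b) = unit (a * b)
  unit_ract : ∀ a b, (fib 0).ract (unit a) b = unit (a * b)
  unit_mul_left : ∀ s a x, HEq (mul 0 s (unit a) x) ((fib s).lactL a x)
  unit_mul_right : ∀ s x a, HEq (mul s 0 x (unit a)) ((fib s).ract x a)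

/-- a representation of a product system in a C*-algebra `B` -/
structure PSRep {k : ℕ} (Xs : PSys A k) (B : Type u) [NonUnitalCStarAlgebra B] :
    Type u where
  π : A → B
  ψ : ∀ s, (Xs.fib s).X → B
  isRep : ∀ s, IsRep (Xs.fib s) π (ψ s)
  ψ_zero : ∀ a, ψ 0 (Xs.unit a) = π a
  mul : ∀ s t x y, ψ s x * ψ t y = ψ (s + t) (Xs.mul s t x y)

/-- Cuntz–Pimsner covariance of a representation of a product system -/
def PSCPCov {k : ℕ} {Xs : PSys A k} {B : Type u} [NonUnitalCStarAlgebra B]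
    (r : PSRep Xs B) : Prop :=
  ∀ s, CPCov (Xs.fib s) r.π (r.ψ s)

/-- The Cuntz–Pimsner algebra `𝒪(X)` of a product system. -/
structure PSCPAlg {k : ℕ} (Xs : PSys A k) : Type (u + 1) where
  O : Type u
  [alg : NonUnitalCStarAlgebra O]
  rep : PSRep Xs O
  covariant : PSCPCov rep
  inj : Function.Injective rep.π
  gen : ∀ S : Set O, IsClosed S →
    (∀ a, rep.π a ∈ S) → (∀ s x, rep.ψ s x ∈ S) →
    (∀ p q, p ∈ S → q ∈ S → p + q ∈ S) →
    (∀ p q, p ∈ S → q ∈ S → p * q ∈ S) →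
    (∀ (c : ℂ) p, p ∈ S → c • p ∈ S) →
    (∀ p, p ∈ S → star p ∈ S) → ∀ z, z ∈ S
  universal : ∀ (C : Type u) [NonUnitalCStarAlgebra C],
    ∀ r : PSRep Xs C, PSCPCov r →
      ∃! h : O →⋆ₙₐ[ℂ] C,
        (∀ a, h (rep.π a) = r.π a) ∧ ∀ s x, h (rep.ψ s x) = r.ψ s x

attribute [instance] PSCPAlg.alg

/- ##################  generating systems  ################## -/

/-- a realization of a triple tensor product `W1 ⊗ W2 ⊗ W3` carrying both
a left pairing `(W1 ⊗ W2) ⊗ W3` and a right pairing `W1 ⊗ (W2 ⊗ W3)` -/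
structure Trip (W1 W2 W3 : Corr A) (T12 : Corr A) (m12 : W1.X → W2.X → T12.X)
    (T23 : Corr A) (m23 : W2.X → W3.X → T23.X) (P : Corr A) : Type u where
  lp : T12.X → W3.X → P.X
  rp : W1.X → T23.X → P.X
  lt : IsTensor T12 W3 P lp
  rt : IsTensor W1 T23 P rp
  compat : ∀ x y z, lp (m12 x y) z = rp x (m23 y z)

/-- the hexagonal relation for a triple of flip isomorphisms
`θij, θil, θjl`, stated relative to arbitrary realizations of the six
triple tensor products. -/
def HexProp (Yi Yj Yl : Corr A)
    (Tij Tji Til Tli Tjl Tlj : Corr A)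
    (mij : Yi.X → Yj.X → Tij.X) (mji : Yj.X → Yi.X → Tji.X)
    (mil : Yi.X → Yl.X → Til.X) (mli : Yl.X → Yi.X → Tli.X)
    (mjl : Yj.X → Yl.X → Tjl.X) (mlj : Yl.X → Yj.X → Tlj.X)
    (θij : Tij.X → Tji.X) (θil : Til.X → Tli.X) (θjl : Tjl.X → Tlj.X) : Prop :=
  ∀ (P1 P2 P3 P4 P5 P6 : Corr A)
    (R1 : Trip Yi Yj Yl Tij mij Tjl mjl P1)
    (R2 : Trip Yj Yi Yl Tji mji Til mil P2)
    (R3 : Trip Yj Yl Yi Tjl mjl Tli mli P3)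
    (R4 : Trip Yl Yj Yi Tlj mlj Tji mji P4)
    (R5 : Trip Yi Yl Yj Til mil Tlj mlj P5)
    (R6 : Trip Yl Yi Yj Tli mli Tij mij P6)
    (F1 : P1.X → P2.X) (F2 : P2.X → P3.X) (F3 : P3.X → P4.X)
    (F4 : P1.X → P5.X) (F5 : P5.X → P6.X) (F6 : P6.X → P4.X),
    IsCLMap F1 → IsCLMap F2 → IsCLMap F3 →
    IsCLMap F4 → IsCLMap F5 → IsCLMap F6 →
    (∀ u z, F1 (R1.lp u z) = R2.lp (θij u) z) →
    (∀ y v, F2 (R2.rp y v) = R3.rp y (θil v)) →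
    (∀ u z, F3 (R3.lp u z) = R4.lp (θjl u) z) →
    (∀ x v, F4 (R1.rp x v) = R5.rp x (θjl v)) →
    (∀ u z, F5 (R5.lp u z) = R6.lp (θil u) z) →
    (∀ x v, F6 (R6.rp x v) = R4.rp x (θij v)) →
    ∀ w, F3 (F2 (F1 w)) = F6 (F5 (F4 w))

/-- A generating system `(Y, θ)` of `k` correspondences over `A`:
correspondences `Y i`, chosen realizations `T i j` of the tensor products
`Y i ⊗_A Y j`, and flip isomorphisms `θ i j : Y i ⊗ Y j → Y j ⊗ Y i` with
`θ i i = id`, `θ j i = (θ i j)⁻¹`, satisfying the hexagonal relations. -/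
structure GenSys (A : Type u) [NonUnitalCStarAlgebra A] (k : ℕ) : Type (u + 1) where
  Y : Fin k → Corr A
  reg : ∀ i, (Y i).Reg
  T : Fin k → Fin k → Corr A
  tmul : ∀ i j, (Y i).X → (Y j).X → (T i j).X
  isTensor : ∀ i j, IsTensor (Y i) (Y j) (T i j) (tmul i j)
  θ : ∀ i j, CorrIso (T i j) (T j i)
  θ_diag : ∀ i x y, (θ i i).toFun (tmul i i x y) = tmul i i x y
  θ_symm : ∀ i j z, (θ j i).toFun ((θ i j).toFun z) = z
  hex : ∀ i j l, HexProp (Y i) (Y j) (Y l) (T i j) (T j i) (T i l) (T l i)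
    (T j l) (T l j) (tmul i j) (tmul j i) (tmul i l) (tmul l i) (tmul j l)
    (tmul l j) ((θ i j).toFun) ((θ i l).toFun) ((θ j l).toFun)

/-- the generating system obtained by keeping only `Y 1, …, Y m` -/
def GenSys.restrict {k : ℕ} (G : GenSys A k) (m : ℕ) (h : m ≤ k) : GenSys A m where
  Y i := G.Y (Fin.castLE h i)
  reg i := G.reg _
  T i j := G.T (Fin.castLE h i) (Fin.castLE h j)
  tmul i j := G.tmul _ _
  isTensor i j := G.isTensor _ _
  θ i j := G.θ _ _
  θ_diag i := G.θ_diag _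
  θ_symm i j := G.θ_symm _ _
  hex i j l := G.hex _ _ _

/-- `X` is *the* product system (over `ℕ^k`) generated by the generating
system `G` (Fowler–Sims); witnessed by compatible isomorphisms on the
generating fibers. -/
structure Generates {k : ℕ} (G : GenSys A k) (Xs : PSys A k) : Type u where
  ι : ∀ i, CorrIso (G.Y i) (Xs.fib (egen i))
  κ : ∀ i j, CorrIso (G.T i j) (Xs.fib (egen i + egen j))
  κ_mul : ∀ i j x y,
    (κ i j).toFun (G.tmul i j x y) =
      Xs.mul (egen i) (egen j) ((ι i).toFun x) ((ι j).toFun y)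
  θ_compat : ∀ i j z,
    HEq ((κ j i).toFun ((G.θ i j).toFun z)) ((κ i j).toFun z)

/- ############  mixed tensor products `W ⊗_A O` and `W ⊗_A V`  ############ -/

/-- `Z` (a correspondence over the C*-algebra `O`), with map `m`, is a
realization of the right Hilbert `O`-module `W ⊗_A O`, where `O` is an
`A`-algebra via `πA`.  (No condition on the left action of `O` on `Z`.) -/
structure MixedMod (W : Corr A) (O : Type u) [NonUnitalCStarAlgebra O]
    (πA : A → O) (Z : Corr O) (m : W.X → O → Z.X) : Prop where
  add_left : ∀ x x' S, m (x + x') S = m x S + m x' S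
  add_right : ∀ x S S', m x (S + S') = m x S + m x S'
  smul_left : ∀ (c : ℂ) x S, m (c • x) S = c • m x S
  smul_right : ∀ (c : ℂ) x S, m x (c • S) = c • m x S
  balanced : ∀ x a S, m (W.ract x a) S = m x (πA a * S)
  ract : ∀ x S T, Z.ract (m x S) T = m x (S * T)
  inner : ∀ x S y T, Z.inner (m x S) (m y T) = star S * (πA (W.inner x y) * T)
  dense : closure (Submodule.span ℂ {z : Z.X | ∃ x S, z = m x S} : Set Z.X) = Set.univ

/-- `P`, with pairing `p`, is a realization of the balanced tensor product
`W ⊗_A V` where `W` is a correspondence over `A` and `V` a correspondence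
over the `A`-algebra `O` (via `πA`); the left `A`-action is `πA`-compatible. -/
structure MixedPair (W : Corr A) {O : Type u} [NonUnitalCStarAlgebra O]
    (πA : A → O) (V P : Corr O) (p : W.X → V.X → P.X) : Prop where
  add_left : ∀ x x' v, p (x + x') v = p x v + p x' v
  add_right : ∀ x v v', p x (v + v') = p x v + p x v'
  smul_left : ∀ (c : ℂ) x v, p (c • x) v = c • p x v
  smul_right : ∀ (c : ℂ) x v, p x (c • v) = c • p x v
  balanced : ∀ x a v, p (W.ract x a) v = p x (V.lactL (πA a) v)
  inner : ∀ x v x' v',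
    P.inner (p x v) (p x' v') = V.inner v (V.lactL (πA (W.inner x x')) v')
  ract : ∀ x v S, P.ract (p x v) S = p x (V.ract v S)
  lact_pi : ∀ a x v, P.lactL (πA a) (p x v) = p (W.lactL a x) v
  dense : closure (Submodule.span ℂ {z : P.X | ∃ x v, z = p x v} : Set P.X) = Set.univ

/- ############  the correspondence `ℰYᵢ = Yᵢ ⊗_A 𝒪(Y₁)`  ############ -/

/-- `Z = Yi ⊗_A 𝒪(Y1)` with the left `𝒪(Y1)`-action determined by the flip
`θ : Y1 ⊗ Yi → Yi ⊗ Y1` (`T` and `T'` are realizations of these tensor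
products):  `π(a)` acts by `φ(a) ⊗ 1`, and `t(x)·(y ⊗ S) = (1 ⊗ V)(θ ⊗ 1)
(x ⊗ y ⊗ S)`. -/
structure ECorrData (Y1 Yi : Corr A)
    (T : Corr A) (mT : Y1.X → Yi.X → T.X)
    (T' : Corr A) (mT' : Yi.X → Y1.X → T'.X)
    (θ : T.X → T'.X)
    (C : CPAlg Y1) (Z : Corr C.O) (m : Yi.X → C.O → Z.X) : Prop where
  mod : MixedMod Yi C.O C.π Z m
  lact_pi : ∀ a y S, Z.lactL (C.π a) (m y S) = m (Yi.lactL a y) S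
  lact_t : ∃ μ : T'.X → C.O → Z.X,
    (∀ S, IsCLMap fun u => μ u S) ∧
    (∀ y u S, μ (mT' y u) S = m y (C.t u * S)) ∧
    ∀ x y S, Z.lactL (C.t x) (m y S) = μ (θ (mT x y)) S

/-- `Z = Yi ⊗_A 𝒪(Y p)` for a generating system `G`, with left action
determined by `θ p i` -/
def ECorr {k : ℕ} (G : GenSys A k) (p i : Fin k) (C : CPAlg (G.Y p))
    (Z : Corr C.O) (m : (G.Y i).X → C.O → Z.X) : Prop :=
  ECorrData (G.Y p) (G.Y i) (G.T p i) (G.tmul p i) (G.T i p) (G.tmul i p)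
    ((G.θ p i).toFun) C Z m

/-- `Z = Y j ⊗_A 𝒪(Y 1 ∗ ⋯ ∗ Y m)` with the left action of the
Cuntz–Pimsner algebra of the product system determined on the generators
`σ i = ψ_{e i}` via the flips `θ i j` and the absorption maps. -/
structure EPCorr {k : ℕ} (G : GenSys A k) {m : ℕ} (hm : m ≤ k)
    (Xs : PSys A m) (gen : Generates (G.restrict m hm) Xs) (C : PSCPAlg Xs)
    (j : Fin k) (Z : Corr C.O) (mm : (G.Y j).X → C.O → Z.X) : Prop where
  mod : MixedMod (G.Y j) C.O C.rep.π Z mm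
  lact_pi : ∀ a y S, Z.lactL (C.rep.π a) (mm y S) = mm ((G.Y j).lactL a y) S
  lact_t : ∀ i : Fin m,
    ∃ μ : (G.T j (Fin.castLE hm i)).X → C.O → Z.X,
      (∀ S, IsCLMap fun u => μ u S) ∧
      (∀ y u S, μ (G.tmul j (Fin.castLE hm i) y u) S =
        mm y (C.rep.ψ (egen i) ((gen.ι i).toFun u) * S)) ∧
      ∀ x y S, Z.lactL (C.rep.ψ (egen i) ((gen.ι i).toFun x)) (mm y S) =
        μ ((G.θ (Fin.castLE hm i) j).toFun (G.tmul (Fin.castLE hm i) j x y)) S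

/- ############  the isomorphism `ℛθ = ν⁻¹ (θ ⊗ 1) ν`  ############ -/

/-- Witness data expressing that `R : Zi ⊗_O Zj → Zj ⊗_O Zi` is the map
`ℛθ_{ij} = ν_{ji}⁻¹ (θ_{ij} ⊗ 1_O) ν_{ij}` of the paper, where
`Zi = Yi ⊗_A O`, `O = 𝒪(Y1)`, and `ν_{ij} : (Yi ⊗ O) ⊗_O (Yj ⊗ O) ≅
Yi ⊗ Yj ⊗ O` is the canonical absorption isomorphism. -/
structure RTheta (O : Type u) [NonUnitalCStarAlgebra O] (πA : A → O)
    (Yi Yj : Corr A) (Tij Tji : Corr A)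
    (mij : Yi.X → Yj.X → Tij.X) (mji : Yj.X → Yi.X → Tji.X)
    (θij : Tij.X → Tji.X)
    (Zi Zj : Corr O) (mmi : Yi.X → O → Zi.X) (mmj : Yj.X → O → Zj.X)
    (TZ TZr : Corr O) (mZ : Zi.X → Zj.X → TZ.X) (mZr : Zj.X → Zi.X → TZr.X)
    (R : TZ.X → TZr.X) : Type (u + 1) where
  Pl : Corr O
  Pr : Corr O
  pij : Yi.X → Zj.X → Pl.X
  pji : Yj.X → Zi.X → Pr.X
  hp : MixedPair Yi πA Zj Pl pij
  hpr : MixedPair Yj πA Zi Pr pji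
  q : Tij.X → O → Pl.X
  qr : Tji.X → O → Pr.X
  hq : MixedMod Tij O πA Pl q
  hqr : MixedMod Tji O πA Pr qr
  q_compat : ∀ x y S, q (mij x y) S = pij x (mmj y S)
  q_compatr : ∀ y x S, qr (mji y x) S = pji y (mmi x S)
  ν : TZ.X → Pl.X
  νr : TZr.X → Pr.X
  hν : IsCLMap ν ∧ Function.Bijective ν ∧
    ∀ x S ζ, ν (mZ (mmi x S) ζ) = pij x (Zj.lactL S ζ)
  hνr : IsCLMap νr ∧ Function.Bijective νr ∧
    ∀ y S ζ, νr (mZr (mmj y S) ζ) = pji y (Zi.lactL S ζ)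
  Θ : Pl.X → Pr.X
  hΘ : IsCLMap Θ ∧ ∀ u S, Θ (q u S) = qr (θij u) S
  hR : ∀ z, νr (R z) = Θ (ν z)

namespace Corr

variable (W : Corr A)

lemma inner_add_left (x y z : W.X) : W.inner (x + y) z = W.inner x z + W.inner y z := by
  rw [← W.inner_star, W.inner_add_right, star_add, W.inner_star, W.inner_star]

lemma inner_smul_left (c : ℂ) (x y : W.X) : W.inner (c • x) y = star c • W.inner x y := by
  rw [← W.inner_star, W.inner_smul_right, star_smul, W.inner_star]

lemma inner_ract_left (x y : W.X) (a : A) : W.inner (W.ract x a) y = star a * W.inner x y := by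
  rw [← W.inner_star, W.inner_ract_right, star_mul, W.inner_star]

/-- The inner product as a linear map in its second variable. -/
def innerLin (x : W.X) : W.X →ₗ[ℂ] A where
  toFun := W.inner x
  map_add' := W.inner_add_right x
  map_smul' c y := W.inner_smul_right c x y

lemma inner_sub_right (x y z : W.X) : W.inner x (y - z) = W.inner x y - W.inner x z :=
  (W.innerLin x).map_sub y z

lemma inner_zero_right (x : W.X) : W.inner x 0 = 0 := (W.innerLin x).map_zero

lemma inner_sub_left (x y z : W.X) : W.inner (x - y) z = W.inner x z - W.inner y z := by
  rw [← W.inner_star, W.inner_sub_right, star_sub, W.inner_star, W.inner_star]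

lemma four_smul_inner (x y : W.X) :
    (4 : ℂ) • W.inner x y = W.inner (x + y) (x + y) - W.inner (x - y) (x - y)
      - Complex.I • W.inner (x + Complex.I • y) (x + Complex.I • y)
      + Complex.I • W.inner (x - Complex.I • y) (x - Complex.I • y) := by
  simp only [inner_add_left, inner_sub_left, W.inner_add_right, inner_sub_right,
    inner_smul_left, W.inner_smul_right, smul_add, smul_sub, smul_smul]
  simp only [Complex.star_def, Complex.conj_I, mul_neg, Complex.I_mul_I, neg_neg,
    neg_smul, one_smul]
  module

lemma norm_inner_le_add_sq (x y : W.X) : ‖W.inner x y‖ ≤ (‖x‖ + ‖y‖) ^ 2 := by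
  have key : ∀ z : W.X, ‖z‖ ≤ ‖x‖ + ‖y‖ → ‖W.inner z z‖ ≤ (‖x‖ + ‖y‖) ^ 2 := fun z hz => by
    rw [← W.norm_eq]
    gcongr
  have hI : ‖Complex.I • y‖ = ‖y‖ := by simp [norm_smul]
  have h1 := key (x + y) (norm_add_le _ _)
  have h2 := key (x - y) (norm_sub_le _ _)
  have h3 := key (x + Complex.I • y) ((norm_add_le _ _).trans (by rw [hI]))
  have h4 := key (x - Complex.I • y) ((norm_sub_le _ _).trans (by rw [hI]))
  have h := congrArg norm (W.four_smul_inner x y)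
  have h5 : ‖(4 : ℂ) • W.inner x y‖ = 4 * ‖W.inner x y‖ := by simp [norm_smul]
  have h6 := norm_add_le
    (W.inner (x + y) (x + y) - W.inner (x - y) (x - y)
      - Complex.I • W.inner (x + Complex.I • y) (x + Complex.I • y))
    (Complex.I • W.inner (x - Complex.I • y) (x - Complex.I • y))
  have h7 := norm_sub_le (W.inner (x + y) (x + y) - W.inner (x - y) (x - y))
    (Complex.I • W.inner (x + Complex.I • y) (x + Complex.I • y))
  have h8 := norm_sub_le (W.inner (x + y) (x + y)) (W.inner (x - y) (x - y))
  rw [norm_smul, Complex.norm_I, one_mul] at h6 h7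
  linarith

/-- A Cauchy–Schwarz estimate (with a constant), obtained by polarization; positivity of the
inner product is not needed. -/
lemma norm_inner_le (x y : W.X) : ‖W.inner x y‖ ≤ 4 * ‖x‖ * ‖y‖ := by
  rcases eq_or_ne x 0 with rfl | hx
  · rw [← W.inner_star, inner_zero_right]
    simp
  rcases eq_or_ne y 0 with rfl | hy
  · rw [inner_zero_right]
    simp
  have hx' : 0 < ‖x‖ := norm_pos_iff.2 hx
  have hy' : 0 < ‖y‖ := norm_pos_iff.2 hy
  have h := W.norm_inner_le_add_sq (((‖x‖⁻¹ : ℝ) : ℂ) • x) (((‖y‖⁻¹ : ℝ) : ℂ) • y)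
  rw [inner_smul_left, W.inner_smul_right, norm_smul, norm_smul, norm_smul, norm_smul,
    norm_star, Complex.norm_real, Complex.norm_real, norm_inv, norm_inv, norm_norm, norm_norm,
    inv_mul_cancel₀ hx'.ne', inv_mul_cancel₀ hy'.ne'] at h
  field_simp at h
  nlinarith

lemma ext_inner {x y : W.X} (h : ∀ z, W.inner z x = W.inner z y) : x = y := by
  have h0 : W.inner (x - y) (x - y) = 0 := by rw [inner_sub_right, h, sub_self]
  have h1 := W.norm_eq (x - y)
  rw [h0, norm_zero] at h1
  exact sub_eq_zero.1 (norm_eq_zero.1 (pow_eq_zero_iff two_ne_zero |>.1 h1))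

lemma lact_ract (a : A) (x : W.X) (b : A) :
    W.lactL a (W.ract x b) = W.ract (W.lactL a x) b := by
  refine W.ext_inner fun z => ?_
  have h : ∀ u v, W.inner u (W.lactL a v) = W.inner (W.lactL (star a) u) v := fun u v => by
    rw [W.lact_adjoint, star_star]
  rw [h, W.inner_ract_right, W.inner_ract_right, h]

/-- The left action as a non-unital algebra homomorphism. -/
def lactHom : A →ₙₐ[ℂ] (W.X →L[ℂ] W.X) where
  toFun := W.lactL
  map_smul' := W.lact_smul
  map_zero' := by simpa using W.lact_smul 0 0
  map_add' := W.lact_add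
  map_mul' := W.lact_mul

lemma norm_lactL_sq_le {h : A} (hh : IsSelfAdjoint h) :
    ‖W.lactL h‖ ^ 2 ≤ 4 * ‖W.lactL (h * h)‖ := by
  have : ‖W.lactL h‖ ≤ Real.sqrt (4 * ‖W.lactL (h * h)‖) := by
    refine ContinuousLinearMap.opNorm_le_bound _ (Real.sqrt_nonneg _) fun x => ?_
    refine le_of_sq_le_sq ?_ (by positivity)
    rw [mul_pow, Real.sq_sqrt (by positivity), W.norm_eq, W.lact_adjoint, hh.star_eq,
      ← ContinuousLinearMap.comp_apply, ← W.lact_mul]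
    calc _ ≤ 4 * ‖x‖ * ‖W.lactL (h * h) x‖ := W.norm_inner_le _ _
      _ ≤ 4 * ‖x‖ * (‖W.lactL (h * h)‖ * ‖x‖) := by
        gcongr
        exact ContinuousLinearMap.le_opNorm _ _
      _ = _ := by ring
  calc _ ≤ Real.sqrt (4 * ‖W.lactL (h * h)‖) ^ 2 := by gcongr
    _ = _ := Real.sq_sqrt (by positivity)

lemma norm_lactL_pow_le {h : A} (hh : IsSelfAdjoint h) (n : ℕ) :
    ‖W.lactL h‖ ^ 2 ^ n ≤ 4 ^ 2 ^ n * ‖W.lactL h ^ 2 ^ n‖ := by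
  suffices H : ∀ n : ℕ, ∃ g : A, IsSelfAdjoint g ∧ W.lactL g = W.lactL h ^ 2 ^ n ∧
      4 * ‖W.lactL h‖ ^ 2 ^ n ≤ 4 ^ 2 ^ n * ‖W.lactL h ^ 2 ^ n‖ by
    obtain ⟨g, -, -, h3⟩ := H n
    have : 0 ≤ ‖W.lactL h‖ ^ 2 ^ n := by positivity
    linarith
  intro n
  induction n with
  | zero => exact ⟨h, hh, by simp, by simp⟩
  | succ n ih =>
    obtain ⟨g, hg, h2, h3⟩ := ih
    refine ⟨g * g, ?_, ?_, ?_⟩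
    · rw [IsSelfAdjoint, star_mul, hg.star_eq]
    · rw [W.lact_mul, h2, pow_succ 2 n, pow_mul, sq]
      rfl
    · have h4 := W.norm_lactL_sq_le hg
      rw [W.lact_mul, h2] at h4
      have h5 : W.lactL h ^ 2 ^ (n + 1) =
          (W.lactL h ^ 2 ^ n).comp (W.lactL h ^ 2 ^ n) := by
        rw [pow_succ 2 n, pow_mul, sq]
        rfl
      rw [h5, pow_succ 2 n, pow_mul, pow_mul]
      have h6 : (4 * ‖W.lactL h‖ ^ 2 ^ n) ^ 2 ≤ (4 ^ 2 ^ n * ‖W.lactL h ^ 2 ^ n‖) ^ 2 := by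
        gcongr
      have h7 : (0 : ℝ) ≤ (4 ^ 2 ^ n) ^ 2 := by positivity
      nlinarith [mul_le_mul_of_nonneg_left h4 h7]

lemma norm_lactL_le_of_isSelfAdjoint {h : A} (hh : IsSelfAdjoint h) :
    ‖W.lactL h‖ ≤ 4 * ‖h‖ := by
  have hs : spectralRadius ℂ (W.lactL h) ≤ ‖h‖₊ := by
    have h1 : Unitization.lift W.lactHom (h : Unitization ℂ A) = W.lactL h := by
      simp [lactHom]
    calc spectralRadius ℂ (W.lactL h) ≤ spectralRadius ℂ (h : Unitization ℂ A) := by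
          rw [← h1]
          exact biSup_mono (AlgHom.spectrum_apply_subset _ _)
      _ ≤ ‖(h : Unitization ℂ A)‖₊ := spectrum.spectralRadius_le_nnnorm _
      _ = ‖h‖₊ := by rw [Unitization.nnnorm_inr]
  have ht := (spectrum.pow_norm_pow_one_div_tendsto_nhds_spectralRadius (W.lactL h)).comp
    (tendsto_pow_atTop_atTop_of_one_lt one_lt_two)
  have hle : ENNReal.ofReal (‖W.lactL h‖ / 4) ≤ spectralRadius ℂ (W.lactL h) := by
    refine ge_of_tendsto ht (Eventually.of_forall fun n => ENNReal.ofReal_le_ofReal ?_)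
    have h2 : (2 ^ n : ℕ) ≠ 0 := by positivity
    calc ‖W.lactL h‖ / 4 = ((‖W.lactL h‖ / 4) ^ (2 ^ n : ℕ)) ^ (1 / ((2 ^ n : ℕ) : ℝ)) := by
          rw [one_div, Real.pow_rpow_inv_natCast (by positivity) h2]
      _ ≤ ‖W.lactL h ^ (2 ^ n : ℕ)‖ ^ (1 / ((2 ^ n : ℕ) : ℝ)) := by
          gcongr
          rw [div_pow, div_le_iff₀' (by positivity)]
          exact W.norm_lactL_pow_le hh n
  have h3 := hle.trans hs
  rw [← enorm_eq_nnnorm, ← ofReal_norm, ENNReal.ofReal_le_ofReal_iff (norm_nonneg _)] at h3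
  linarith

/-- The left action of a correspondence is automatically bounded. -/
lemma norm_lactL_le (a : A) : ‖W.lactL a‖ ≤ 4 * ‖a‖ := by
  refine ContinuousLinearMap.opNorm_le_bound _ (by positivity) fun x => ?_
  refine le_of_sq_le_sq ?_ (by positivity)
  rw [W.norm_eq, W.lact_adjoint, ← ContinuousLinearMap.comp_apply, ← W.lact_mul]
  calc _ ≤ 4 * ‖x‖ * ‖W.lactL (star a * a) x‖ := W.norm_inner_le _ _
    _ ≤ 4 * ‖x‖ * (4 * ‖star a * a‖ * ‖x‖) := by
      gcongr
      exact (W.lactL _).le_of_opNorm_le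
        (W.norm_lactL_le_of_isSelfAdjoint (IsSelfAdjoint.star_mul_self a)) x
    _ = _ := by rw [CStarRing.norm_star_mul_self]; ring

lemma norm_inner_lactL_le (a : A) (x y : W.X) :
    ‖W.inner x (W.lactL a y)‖ ≤ 16 * ‖a‖ * ‖x‖ * ‖y‖ := by
  calc _ ≤ 4 * ‖x‖ * ‖W.lactL a y‖ := W.norm_inner_le _ _
    _ ≤ 4 * ‖x‖ * (4 * ‖a‖ * ‖y‖) := by
      gcongr
      exact (W.lactL a).le_of_opNorm_le (W.norm_lactL_le a) y
    _ = _ := by ring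

end Corr

lemma IsCLMap.of_bound {E F : Type u} [NormedAddCommGroup E] [NormedSpace ℂ E]
    [NormedAddCommGroup F] [NormedSpace ℂ F] {f : E → F}
    (hadd : ∀ x y, f (x + y) = f x + f y) (hsmul : ∀ (c : ℂ) x, f (c • x) = c • f x)
    (C : ℝ) (h : ∀ x, ‖f x‖ ^ 2 ≤ C ^ 2 * ‖x‖ ^ 2) : IsCLMap f where
  map_add := hadd
  map_smul := hsmul
  cont := by
    let g : E →ₗ[ℂ] F := { toFun := f, map_add' := hadd, map_smul' := hsmul }
    refine (g.mkContinuous |C| fun x => ?_).continuous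
    refine le_of_sq_le_sq ?_ (by positivity)
    rw [mul_pow, sq_abs]
    exact h x

namespace IsCLMap

variable {E F F' : Type u} [NormedAddCommGroup E] [NormedSpace ℂ E]
  [NormedAddCommGroup F] [NormedSpace ℂ F] [NormedAddCommGroup F'] [NormedSpace ℂ F']

/-- The continuous linear map underlying a function satisfying `IsCLMap`. -/
def toCLM {f : E → F} (hf : IsCLMap f) : E →L[ℂ] F where
  toFun := f
  map_add' := hf.map_add
  map_smul' := hf.map_smul
  cont := hf.cont

lemma of_clm (f : E →L[ℂ] F) : IsCLMap f := ⟨f.map_add, f.map_smul, f.continuous⟩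

lemma comp {g : F → F'} {f : E → F} (hg : IsCLMap g) (hf : IsCLMap f) :
    IsCLMap fun x => g (f x) :=
  of_clm (hg.toCLM.comp hf.toCLM)

/-- A continuous linear map sends the closed span of `s` into a closed subspace as soon as it
sends `s` into it. -/
lemma mem_of_dense {f : E → F} (hf : IsCLMap f) {s : Set E}
    (hs : closure (Submodule.span ℂ s : Set E) = Set.univ) {K : Submodule ℂ F}
    (hK : IsClosed (K : Set F)) (h : ∀ x ∈ s, f x ∈ K) (x : E) : f x ∈ K := by
  have h1 : Submodule.span ℂ s ≤ K.comap hf.toCLM.toLinearMap := Submodule.span_le.2 h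
  have h2 : closure (Submodule.span ℂ s : Set E) ⊆ f ⁻¹' K :=
    closure_minimal h1 (hK.preimage hf.cont)
  exact h2 (hs ▸ Set.mem_univ x)

lemma ext_of_dense {f g : E → F} (hf : IsCLMap f) (hg : IsCLMap g) {s : Set E}
    (hs : closure (Submodule.span ℂ s : Set E) = Set.univ) (h : ∀ x ∈ s, f x = g x) (x : E) :
    f x = g x :=
  congrArg (· x) (ContinuousLinearMap.ext_on (f := hf.toCLM) (g := hg.toCLM)
    (dense_iff_closure_eq.2 hs) h)

end IsCLMap

lemma isCLMap_id {E : Type u} [NormedAddCommGroup E] [NormedSpace ℂ E] :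
    IsCLMap fun x : E => x :=
  IsCLMap.of_clm (ContinuousLinearMap.id ℂ E)

lemma closure_span_eq_univ_of_subset {E : Type u} [NormedAddCommGroup E] [NormedSpace ℂ E]
    {s t : Set E} (hs : closure (Submodule.span ℂ s : Set E) = Set.univ)
    (h : ∀ x ∈ s, x ∈ (Submodule.span ℂ t).topologicalClosure) :
    closure (Submodule.span ℂ t : Set E) = Set.univ :=
  Set.eq_univ_of_forall fun x =>
    isCLMap_id.mem_of_dense hs (Submodule.isClosed_topologicalClosure _) h x

lemma mem_topologicalClosure_span {E : Type u} [NormedAddCommGroup E] [NormedSpace ℂ E]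
    {t : Set E} {x : E} (h : x ∈ t) : x ∈ (Submodule.span ℂ t).topologicalClosure :=
  Submodule.le_topologicalClosure _ (Submodule.subset_span h)

lemma IsStarHom.norm_le {π : A → B} (hπ : IsStarHom π) (a : A) : ‖π a‖ ≤ ‖a‖ := by
  let φ : A →⋆ₙₐ[ℂ] B :=
    { toFun := π
      map_smul' := hπ.map_smul
      map_zero' := by simpa using hπ.map_smul 0 0
      map_add' := hπ.map_add
      map_mul' := hπ.map_mul
      map_star' := hπ.map_star }
  exact NonUnitalStarAlgHom.norm_apply_le φ a

lemma isStarHom_id : IsStarHom fun a : A => a :=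
  ⟨fun _ _ => rfl, fun _ _ => rfl, fun _ => rfl, fun _ _ => rfl⟩

namespace Corr

variable (W : Corr A)

lemma isCLMap_ract (a : A) : IsCLMap fun x => W.ract x a :=
  IsCLMap.of_bound (fun x y => W.ract_add_left x y a) (fun c x => W.ract_smul c x a) ‖a‖
    fun x => by
      rw [W.norm_eq, inner_ract_left, W.inner_ract_right, W.norm_eq]
      calc _ ≤ ‖star a‖ * (‖W.inner x x‖ * ‖a‖) :=
            (norm_mul_le _ _).trans (by gcongr; exact norm_mul_le _ _)
        _ = _ := by rw [norm_star]; ring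

lemma isCLMap_inner (x : W.X) : IsCLMap (W.inner x) :=
  IsCLMap.of_bound (W.inner_add_right x) (fun c y => W.inner_smul_right c x y) (4 * ‖x‖)
    fun y => by
      rw [← mul_pow]
      gcongr
      exact W.norm_inner_le x y

lemma isCLMap_lactL (a : A) : IsCLMap fun x => W.lactL a x := IsCLMap.of_clm _

/-- The elements `x ⬝ a` span a dense subspace of a Hilbert module. -/
lemma dense_ract : closure (Submodule.span ℂ {y : W.X | ∃ x a, y = W.ract x a} : Set W.X)
    = Set.univ := by
  refine Set.eq_univ_of_forall fun x => ?_
  let : PartialOrder A := CStarAlgebra.spectralOrder A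
  have : StarOrderedRing A := CStarAlgebra.spectralOrderedRing A
  have hl := CStarAlgebra.increasingApproximateUnit A
  have := hl.neBot
  have h0 : Tendsto (fun e => ‖W.inner x x - W.inner x x * e‖)
      (CStarAlgebra.approximateUnit A) (𝓝 0) := by
    simpa using ((tendsto_const_nhds (x := W.inner x x)).sub (hl.tendsto_mul_left (W.inner x x))).norm
  have h1 : Tendsto (fun e => W.ract x e) (CStarAlgebra.approximateUnit A) (𝓝 x) := by
    rw [tendsto_iff_norm_sub_tendsto_zero]
    have h2 : Tendsto (fun e => ‖W.ract x e - x‖ ^ 2) (CStarAlgebra.approximateUnit A) (𝓝 0) := by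
      refine squeeze_zero' (Eventually.of_forall fun e => by positivity) ?_
        (by simpa using h0.const_mul 2)
      filter_upwards [hl.eventually_norm] with e he
      have h3 : W.inner (W.ract x e - x) (W.ract x e - x) =
          (W.inner x x - W.inner x x * e) - star e * (W.inner x x - W.inner x x * e) := by
        simp only [inner_sub_left, inner_sub_right, inner_ract_left, W.inner_ract_right, mul_sub,
          sub_mul, mul_assoc]
        abel
      rw [W.norm_eq, h3]
      calc _ ≤ ‖W.inner x x - W.inner x x * e‖ + ‖star e‖ * ‖W.inner x x - W.inner x x * e‖ :=
            (norm_sub_le _ _).trans (by gcongr; exact norm_mul_le _ _)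
        _ ≤ ‖W.inner x x - W.inner x x * e‖ + 1 * ‖W.inner x x - W.inner x x * e‖ := by
          rw [norm_star]
          gcongr
        _ = _ := by ring
    simpa using h2.sqrt
  exact mem_closure_of_tendsto h1
    (Eventually.of_forall fun e => Submodule.subset_span ⟨x, e, rfl⟩)

end Corr

lemma inner_map_of_dense {W : Corr A} {Z : Corr B} {π : A → B} (hπ : IsStarHom π)
    {f : W.X → Z.X} (hf : IsCLMap f) {s : Set W.X}
    (hs : closure (Submodule.span ℂ s : Set W.X) = Set.univ)
    (h : ∀ x ∈ s, ∀ y ∈ s, Z.inner (f x) (f y) = π (W.inner x y)) (x y : W.X) :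
    Z.inner (f x) (f y) = π (W.inner x y) := by
  have hπc : IsCLMap π := IsCLMap.of_bound hπ.map_add hπ.map_smul 1 fun a => by
    rw [one_pow, one_mul]
    gcongr
    exact hπ.norm_le a
  have h1 : ∀ x ∈ s, ∀ y, Z.inner (f x) (f y) = π (W.inner x y) := fun x hx =>
    ((Z.isCLMap_inner _).comp hf).ext_of_dense (hπc.comp (W.isCLMap_inner x)) hs (h x hx)
  refine ((Z.isCLMap_inner _).comp hf).ext_of_dense (hπc.comp (W.isCLMap_inner x)) hs
    (fun y hy => ?_) y
  rw [← Z.inner_star, h1 y hy, ← hπ.map_star, W.inner_star]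

/-- A map defined on a total family and compatible with the inner products extends to a
continuous linear map compatible with the inner products. -/
lemma exists_isCLMap_of_inner {W : Corr A} {Z : Corr B} {π : A → B} (hπ : IsStarHom π)
    {I : Type u} (e : I → W.X) (f : I → Z.X)
    (hd : closure (Submodule.span ℂ (Set.range e) : Set W.X) = Set.univ)
    (h : ∀ i j, Z.inner (f i) (f j) = π (W.inner (e i) (e j))) :
    ∃ L : W.X → Z.X, IsCLMap L ∧ (∀ i, L (e i) = f i) ∧
      ∀ x y, Z.inner (L x) (L y) = π (W.inner x y) := by
  let g := Finsupp.linearCombination ℂ e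
  let k := Finsupp.linearCombination ℂ f
  have hπ0 : π 0 = 0 := by simpa using hπ.map_smul 0 0
  have h1 : ∀ i c, Z.inner (f i) (k c) = π (W.inner (e i) (g c)) := fun i c => by
    induction c using Finsupp.induction_linear with
    | zero => simp [Corr.inner_zero_right, hπ0]
    | add c d hc hd => simp only [map_add, Z.inner_add_right, W.inner_add_right, hπ.map_add, hc, hd]
    | single j z => simp [k, g, Z.inner_smul_right, W.inner_smul_right, hπ.map_smul, h]
  have h2 : ∀ b c, Z.inner (k b) (k c) = π (W.inner (g b) (g c)) := fun b c => by
    induction b using Finsupp.induction_linear with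
    | zero => rw [← Z.inner_star, ← W.inner_star]; simp [Corr.inner_zero_right, hπ0]
    | add b d hb hd =>
      simp only [map_add, Corr.inner_add_left, hπ.map_add, hb, hd]
    | single j z => simp only [k, g, Finsupp.linearCombination_single, Corr.inner_smul_left,
        hπ.map_smul, ← h1]
  have hg : DenseRange g := by
    rw [DenseRange, dense_iff_closure_eq, ← hd, ← Finsupp.range_linearCombination]
    rfl
  have hb : ∃ C : ℝ, ∀ c, ‖k c‖ ≤ C * ‖g c‖ := ⟨1, fun c => by
    refine le_of_sq_le_sq ?_ (by positivity)
    rw [one_mul, Z.norm_eq, h2, W.norm_eq]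
    exact hπ.norm_le _⟩
  have hL : ∀ c, k.extendOfNorm g (g c) = k c := LinearMap.extendOfNorm_eq hg hb
  have hLe : ∀ i, k.extendOfNorm g (e i) = f i := fun i => by
    simpa [k, g] using hL (Finsupp.single i 1)
  refine ⟨_, IsCLMap.of_clm (k.extendOfNorm g), hLe,
    inner_map_of_dense hπ (IsCLMap.of_clm (k.extendOfNorm g)) hd ?_⟩
  rintro _ ⟨i, rfl⟩ _ ⟨j, rfl⟩
  rw [hLe, hLe, h]

namespace IsTensor

variable {W V T : Corr A} {m : W.X → V.X → T.X}

lemma norm_sq_le (h : IsTensor W V T m) (x : W.X) (y : V.X) :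
    ‖m x y‖ ^ 2 ≤ (4 * ‖x‖) ^ 2 * ‖y‖ ^ 2 := by
  rw [T.norm_eq, h.inner]
  refine (V.norm_inner_lactL_le _ _ _).trans (le_of_eq ?_)
  rw [← W.norm_eq]
  ring

lemma isCLMap_left (h : IsTensor W V T m) (y : V.X) : IsCLMap fun x => m x y :=
  IsCLMap.of_bound (fun x x' => h.add_left x x' y) (fun c x => h.smul_left c x y) (4 * ‖y‖)
    fun x => (h.norm_sq_le x y).trans (le_of_eq (by ring))

lemma isCLMap_right (h : IsTensor W V T m) (x : W.X) : IsCLMap (m x) :=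
  IsCLMap.of_bound (h.add_right x) (fun c y => h.smul_right c x y) (4 * ‖x‖)
    (h.norm_sq_le x)

end IsTensor

namespace MixedPair

variable {W : Corr A} {π : A → B} {V P : Corr B} {p : W.X → V.X → P.X}

lemma norm_sq_le (h : MixedPair W π V P p) (hπ : IsStarHom π) (x : W.X) (v : V.X) :
    ‖p x v‖ ^ 2 ≤ (4 * ‖x‖) ^ 2 * ‖v‖ ^ 2 := by
  rw [P.norm_eq, h.inner]
  calc _ ≤ 16 * ‖π (W.inner x x)‖ * ‖v‖ * ‖v‖ := V.norm_inner_lactL_le _ _ _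
    _ ≤ 16 * ‖W.inner x x‖ * ‖v‖ * ‖v‖ := by
      gcongr
      exact hπ.norm_le _
    _ = _ := by rw [← W.norm_eq]; ring

lemma isCLMap_left (h : MixedPair W π V P p) (hπ : IsStarHom π) (v : V.X) :
    IsCLMap fun x => p x v :=
  IsCLMap.of_bound (fun x x' => h.add_left x x' v) (fun c x => h.smul_left c x v) (4 * ‖v‖)
    fun x => (h.norm_sq_le hπ x v).trans (le_of_eq (by ring))

lemma isCLMap_right (h : MixedPair W π V P p) (hπ : IsStarHom π) (x : W.X) : IsCLMap (p x) :=
  IsCLMap.of_bound (h.add_right x) (fun c v => h.smul_right c x v) (4 * ‖x‖)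
    (h.norm_sq_le hπ x)

end MixedPair

lemma MixedMod.isCLMap_left {W : Corr A} {π : A → B} {Z : Corr B} {m : W.X → B → Z.X}
    (h : MixedMod W B π Z m) (hπ : IsStarHom π) (S : B) : IsCLMap fun x => m x S :=
  IsCLMap.of_bound (fun x x' => h.add_left x x' S) (fun c x => h.smul_left c x S) ‖S‖
    fun x => by
      rw [Z.norm_eq, h.inner, W.norm_eq]
      calc _ ≤ ‖star S‖ * (‖π (W.inner x x)‖ * ‖S‖) :=
            (norm_mul_le _ _).trans (by gcongr; exact norm_mul_le _ _)
        _ ≤ ‖S‖ * (‖W.inner x x‖ * ‖S‖) := by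
          rw [norm_star]
          gcongr
          exact hπ.norm_le _
        _ = _ := by ring

/-- `ι` is an inner-product-compatible embedding of `W` into `U` whose image generates `U` as a
right Hilbert module. -/
structure IsGenEmb (π : A → B) (W : Corr A) (U : Corr B) (ι : W.X → U.X) : Prop where
  isCLMap : IsCLMap ι
  inner : ∀ x y, U.inner (ι x) (ι y) = π (W.inner x y)
  dense : closure (Submodule.span ℂ {z : U.X | ∃ x S, z = U.ract (ι x) S} : Set U.X) = Set.univ

/-- The embedding `y ↦ y ⊗ 1` of `W` into `W ⊗_A B`. -/
lemma MixedMod.exists_isGenEmb {W : Corr A} {π : A → B} {Z : Corr B} {m : W.X → B → Z.X}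
    (h : MixedMod W B π Z m) (hπ : IsStarHom π)
    (hl : ∀ a y S, Z.lactL (π a) (m y S) = m (W.lactL a y) S) :
    ∃ ι : W.X → Z.X, IsGenEmb π W Z ι ∧ (∀ x S, Z.ract (ι x) S = m x S) ∧
      (∀ x a, ι (W.ract x a) = m x (π a)) ∧
      ∀ a x, Z.lactL (π a) (ι x) = ι (W.lactL a x) := by
  have hset : {y : W.X | ∃ x a, y = W.ract x a} =
      Set.range fun q : W.X × A => W.ract q.1 q.2 := by
    ext y
    simp [eq_comm]
  obtain ⟨ι, hι, he, hi⟩ := exists_isCLMap_of_inner (Z := Z) hπ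
    (fun q : W.X × A => W.ract q.1 q.2) (fun q => m q.1 (π q.2)) (hset ▸ W.dense_ract)
    fun q q' => by
      rw [h.inner, W.inner_ract_right, Corr.inner_ract_left, hπ.map_mul, hπ.map_mul,
        hπ.map_star, mul_assoc]
  have he' : ∀ x a, ι (W.ract x a) = m x (π a) := fun x a => he (x, a)
  have hr : ∀ x S, Z.ract (ι x) S = m x S := fun x S =>
    ((Z.isCLMap_ract S).comp hι).ext_of_dense (h.isCLMap_left hπ S) W.dense_ract
      (by rintro _ ⟨x, a, rfl⟩; rw [he', h.ract, h.balanced]) x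
  refine ⟨ι, ⟨hι, hi, ?_⟩, hr, he', fun a => ?_⟩
  · simpa only [hr] using h.dense
  · refine ((Z.isCLMap_lactL (π a)).comp hι).ext_of_dense (hι.comp (W.isCLMap_lactL a))
      W.dense_ract ?_
    rintro _ ⟨x, b, rfl⟩
    rw [he', hl, Corr.lact_ract, he']

section Absorption

variable {π : A → B} {W : Corr A} {U V T P : Corr B} {ι : W.X → U.X}
  {m : U.X → V.X → T.X} {p : W.X → V.X → P.X}

lemma IsGenEmb.dense_tensor (hι : IsGenEmb π W U ι) (hm : IsTensor U V T m) :
    closure (Submodule.span ℂ {z : T.X | ∃ x v, z = m (ι x) v} : Set T.X) = Set.univ := by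
  refine closure_span_eq_univ_of_subset hm.dense ?_
  rintro _ ⟨u, v, rfl⟩
  refine (hm.isCLMap_left v).mem_of_dense hι.dense (Submodule.isClosed_topologicalClosure _) ?_ u
  rintro _ ⟨x, S, rfl⟩
  exact mem_topologicalClosure_span ⟨x, V.lactL S v, hm.balanced _ _ _⟩

/-- Absorption: `U ⊗_B V ≅ W ⊗_A V` when `W` generates `U`. -/
lemma IsGenEmb.exists_absorption (hι : IsGenEmb π W U ι) (hm : IsTensor U V T m)
    (hp : MixedPair W π V P p) : ∃ ν : T.X → P.X, IsCLMap ν ∧ ∀ x v, ν (m (ι x) v) = p x v := by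
  have hset : {z : T.X | ∃ x v, z = m (ι x) v} =
      Set.range fun q : W.X × V.X => m (ι q.1) q.2 := by
    ext y
    simp [eq_comm]
  obtain ⟨ν, hν, he, -⟩ := exists_isCLMap_of_inner (W := T) (Z := P) isStarHom_id
    (fun q : W.X × V.X => m (ι q.1) q.2) (fun q => p q.1 q.2) (hset ▸ hι.dense_tensor hm)
    fun q q' => by rw [hp.inner, hm.inner, hι.inner]
  exact ⟨ν, hν, fun x v => he (x, v)⟩

end Absorption

/-- The tensor product of two generating embeddings is a generating embedding. -/
lemma IsGenEmb.exists_tensor {π : A → B} (hπ : IsStarHom π) {Wa Wb T : Corr A}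
    {m : Wa.X → Wb.X → T.X} (hT : IsTensor Wa Wb T m) {Za Zb TZ : Corr B}
    {mZ : Za.X → Zb.X → TZ.X} (hTZ : IsTensor Za Zb TZ mZ) {ιa : Wa.X → Za.X}
    {ιb : Wb.X → Zb.X} (ha : IsGenEmb π Wa Za ιa) (hb : IsGenEmb π Wb Zb ιb)
    (hl : ∀ a x, Zb.lactL (π a) (ιb x) = ιb (Wb.lactL a x)) :
    ∃ ρ : T.X → TZ.X, IsGenEmb π T TZ ρ ∧ ∀ x y, ρ (m x y) = mZ (ιa x) (ιb y) := by
  have hset : {z : T.X | ∃ x y, z = m x y} =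
      Set.range fun q : Wa.X × Wb.X => m q.1 q.2 := by
    ext y
    simp [eq_comm]
  obtain ⟨ρ, hρ, he, hi⟩ := exists_isCLMap_of_inner (Z := TZ) hπ
    (fun q : Wa.X × Wb.X => m q.1 q.2) (fun q => mZ (ιa q.1) (ιb q.2)) (hset ▸ hT.dense)
    fun q q' => by rw [hTZ.inner, ha.inner, hl, hb.inner, hT.inner]
  refine ⟨ρ, ⟨hρ, hi, closure_span_eq_univ_of_subset (ha.dense_tensor hTZ) ?_⟩,
    fun x y => he (x, y)⟩
  rintro _ ⟨x, v, rfl⟩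
  refine (hTZ.isCLMap_right (ιa x)).mem_of_dense hb.dense
    (Submodule.isClosed_topologicalClosure _) ?_ v
  rintro _ ⟨y, S, rfl⟩
  exact mem_topologicalClosure_span ⟨m x y, S, by rw [he (x, y), hTZ.ract]⟩

/-- If `ν ((x ⊗ S) ⊗ v) = x ⊗ S ⬝ g v`, then `ν ((x ⊗ 1) ⊗ v) = x ⊗ g v`. -/
lemma absorption_apply_embedding {π : A → B} (hπ : IsStarHom π) {W : Corr A}
    {U V T V' P : Corr B} {mm : W.X → B → U.X} {ι : W.X → U.X} {m : U.X → V.X → T.X}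
    {p : W.X → V'.X → P.X} (hι : IsCLMap ι) (hιm : ∀ x a, ι (W.ract x a) = mm x (π a))
    (hm : IsTensor U V T m) (hp : MixedPair W π V' P p) {g : V.X → V'.X} {ν : T.X → P.X}
    (hν : IsCLMap ν) (h : ∀ x S v, ν (m (mm x S) v) = p x (V'.lactL S (g v))) (x : W.X) (v : V.X) :
    ν (m (ι x) v) = p x (g v) := by
  refine (hν.comp ((hm.isCLMap_left v).comp hι)).ext_of_dense (hp.isCLMap_left hπ (g v))
    W.dense_ract ?_ x
  rintro _ ⟨x, a, rfl⟩
  rw [hιm, h, hp.balanced]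

section RTheta

variable {π : A → B} {Wa Wb T : Corr A} {m : Wa.X → Wb.X → T.X} {Za Zb TZ P : Corr B}
  {mmb : Wb.X → B → Zb.X} {mZ : Za.X → Zb.X → TZ.X} {ιa : Wa.X → Za.X} {ιb : Wb.X → Zb.X}
  {ρ : T.X → TZ.X} {p : Wa.X → Zb.X → P.X} {q : T.X → B → P.X} {ν : TZ.X → P.X}

lemma absorption_apply_ract (hπ : IsStarHom π) (hT : IsTensor Wa Wb T m)
    (hTZ : IsTensor Za Zb TZ mZ) (hιb : ∀ y S, Zb.ract (ιb y) S = mmb y S) (hρ : IsCLMap ρ)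
    (hρm : ∀ x y, ρ (m x y) = mZ (ιa x) (ιb y)) (hq : MixedMod T B π P q)
    (hqc : ∀ x y S, q (m x y) S = p x (mmb y S)) (hν : IsCLMap ν)
    (hνι : ∀ x v, ν (mZ (ιa x) v) = p x v) (u : T.X) (S : B) :
    ν (TZ.ract (ρ u) S) = q u S := by
  refine (hν.comp ((TZ.isCLMap_ract S).comp hρ)).ext_of_dense (hq.isCLMap_left hπ S) hT.dense ?_ u
  rintro _ ⟨x, y, rfl⟩
  rw [hρm, hTZ.ract, hνι, hιb, hqc]

end RTheta

/-- `ℛθ` is the unique continuous linear map with `ρ(u) ⬝ S ↦ ρ(θ u) ⬝ S`. -/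
lemma RTheta.isCLMap_and_apply {π : A → B} (hπ : IsStarHom π) {Wa Wb Tab Tba : Corr A}
    {mab : Wa.X → Wb.X → Tab.X} {mba : Wb.X → Wa.X → Tba.X} {θ : Tab.X → Tba.X}
    {Za Zb TZab TZba : Corr B} {mma : Wa.X → B → Za.X} {mmb : Wb.X → B → Zb.X}
    {mZab : Za.X → Zb.X → TZab.X} {mZba : Zb.X → Za.X → TZba.X} {R : TZab.X → TZba.X}
    (D : RTheta B π Wa Wb Tab Tba mab mba θ Za Zb mma mmb TZab TZba mZab mZba R)
    (hTab : IsTensor Wa Wb Tab mab) (hTba : IsTensor Wb Wa Tba mba)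
    (hTZab : IsTensor Za Zb TZab mZab) (hTZba : IsTensor Zb Za TZba mZba)
    {ιa : Wa.X → Za.X} {ιb : Wb.X → Zb.X} (hιa : IsCLMap ιa) (hιb : IsCLMap ιb)
    (ha : ∀ x S, Za.ract (ιa x) S = mma x S) (hb : ∀ x S, Zb.ract (ιb x) S = mmb x S)
    (ha' : ∀ x a, ιa (Wa.ract x a) = mma x (π a)) (hb' : ∀ x a, ιb (Wb.ract x a) = mmb x (π a))
    {ρab : Tab.X → TZab.X} {ρba : Tba.X → TZba.X} (hρab : IsCLMap ρab) (hρba : IsCLMap ρba)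
    (hab : ∀ x y, ρab (mab x y) = mZab (ιa x) (ιb y))
    (hba : ∀ x y, ρba (mba x y) = mZba (ιb x) (ιa y)) :
    IsCLMap R ∧ ∀ u S, R (TZab.ract (ρab u) S) = TZba.ract (ρba (θ u)) S := by
  obtain ⟨hν, -, hνm⟩ := D.hν
  obtain ⟨hνr, hνrb, hνrm⟩ := D.hνr
  obtain ⟨hΘ, hΘq⟩ := D.hΘ
  have hνι := absorption_apply_embedding hπ hιa ha' hTZab D.hp hν (g := fun v => v) hνm
  have hνrι := absorption_apply_embedding hπ hιb hb' hTZba D.hpr hνr (g := fun v => v) hνrm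
  let e := ContinuousLinearEquiv.ofBijective hνr.toCLM (LinearMap.ker_eq_bot.2 hνrb.1)
    (LinearMap.range_eq_top.2 hνrb.2)
  have he : ∀ z, e z = D.νr z := fun z => rfl
  have hR : R = fun z => e.symm (D.Θ (D.ν z)) := funext fun z => by
    rw [ContinuousLinearEquiv.eq_symm_apply, he, D.hR]
  refine ⟨?_, fun u S => hνrb.1 ?_⟩
  · rw [hR]
    exact (IsCLMap.of_clm (e.symm : D.Pr.X →L[ℂ] TZba.X)).comp (hΘ.comp hν)
  · rw [D.hR, absorption_apply_ract hπ hTab hTZab hb hρab hab D.hq D.q_compat hν hνι, hΘq,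
      absorption_apply_ract hπ hTba hTZba ha hρba hba D.hqr D.q_compatr hνr hνrι]

section TripleAbsorption

/-- `ξ` is the triple absorption map `Za ⊗ Zb ⊗ Zc → Wa ⊗ Wb ⊗ Zc`, described on elements of
both bracketings. -/
structure IsTripleAbsorption {Wa T : Corr A} {Za Zb Zc TZab TZbc P V Q : Corr B}
    {mZab : Za.X → Zb.X → TZab.X} {mZbc : Zb.X → Zc.X → TZbc.X}
    (R : Trip Za Zb Zc TZab mZab TZbc mZbc P) (ιa : Wa.X → Za.X) (ρ : T.X → TZab.X)
    (ν : TZbc.X → V.X) (qQ : Wa.X → V.X → Q.X) (qT : T.X → Zc.X → Q.X) (ξ : P.X → Q.X) :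
    Prop where
  isCLMap : IsCLMap ξ
  lp : ∀ u v, ξ (R.lp (ρ u) v) = qT u v
  rp : ∀ x v, ξ (R.rp (ιa x) v) = qQ x (ν v)

variable {π : A → B} {Wa Wb T : Corr A} {m : Wa.X → Wb.X → T.X}
  {Za Zb Zc TZab TZbc P V Q : Corr B}
  {mZab : Za.X → Zb.X → TZab.X} {mZbc : Zb.X → Zc.X → TZbc.X}
  {R : Trip Za Zb Zc TZab mZab TZbc mZbc P} {ιa : Wa.X → Za.X} {ιb : Wb.X → Zb.X}
  {ρ : T.X → TZab.X} {p : Wb.X → Zc.X → V.X}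
  {ν : TZbc.X → V.X} {qQ : Wa.X → V.X → Q.X} {qT : T.X → Zc.X → Q.X} {ξ : P.X → Q.X}

lemma IsTripleAbsorption.of_rp (hπ : IsStarHom π) (hT : IsTensor Wa Wb T m) (hρ : IsCLMap ρ)
    (hρm : ∀ x y, ρ (m x y) = mZab (ιa x) (ιb y)) (hqT : MixedPair T π Zc Q qT)
    (hc : ∀ x y v, qT (m x y) v = qQ x (p y v)) (hνι : ∀ y v, ν (mZbc (ιb y) v) = p y v)
    (hξ : IsCLMap ξ) (h : ∀ x v, ξ (R.rp (ιa x) v) = qQ x (ν v)) :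
    IsTripleAbsorption R ιa ρ ν qQ qT ξ := by
  refine ⟨hξ, fun u v => ?_, h⟩
  refine (hξ.comp ((R.lt.isCLMap_left v).comp hρ)).ext_of_dense (hqT.isCLMap_left hπ v)
    hT.dense ?_ u
  rintro _ ⟨x, y, rfl⟩
  rw [hρm, R.compat, h, hνι, hc]

lemma exists_isTripleAbsorption (hπ : IsStarHom π) (hb : IsGenEmb π Wb Zb ιb)
    (hZbc : IsTensor Zb Zc TZbc mZbc) (hρ : IsGenEmb π T TZab ρ)
    (hρm : ∀ x y, ρ (m x y) = mZab (ιa x) (ιb y)) (hqQ : MixedPair Wa π V Q qQ)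
    (hqT : MixedPair T π Zc Q qT) (hc : ∀ x y v, qT (m x y) v = qQ x (p y v))
    (hν : IsCLMap ν) (hνι : ∀ y v, ν (mZbc (ιb y) v) = p y v) :
    ∃ ξ, IsTripleAbsorption R ιa ρ ν qQ qT ξ := by
  obtain ⟨ξ, hξ, h⟩ := hρ.exists_absorption R.lt hqT
  refine ⟨ξ, hξ, h, fun x => ?_⟩
  refine (hξ.comp (R.rt.isCLMap_right (ιa x))).ext_of_dense ((hqQ.isCLMap_right hπ x).comp hν)
    (hb.dense_tensor hZbc) ?_
  rintro _ ⟨y, v, rfl⟩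
  rw [← R.compat, ← hρm, h, hc, hνι]

end TripleAbsorption

/-- Absorption intertwines `ℛθ ⊗ 1` with `θ ⊗ 1`. -/
lemma IsTripleAbsorption.comm_left {π : A → B} {W T W' T' : Corr A}
    {Za Zb Zc TZab TZbc P V Q TZba TZac P' V' Q' : Corr B}
    {mZab : Za.X → Zb.X → TZab.X} {mZbc : Zb.X → Zc.X → TZbc.X}
    {mZba : Zb.X → Za.X → TZba.X} {mZac : Za.X → Zc.X → TZac.X}
    {D : Trip Za Zb Zc TZab mZab TZbc mZbc P} {D' : Trip Zb Za Zc TZba mZba TZac mZac P'}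
    {ι : W.X → Za.X} {ι' : W'.X → Zb.X} {ρ : T.X → TZab.X} {ρ' : T'.X → TZba.X}
    {ν : TZbc.X → V.X} {ν' : TZac.X → V'.X} {qQ : W.X → V.X → Q.X} {qQ' : W'.X → V'.X → Q'.X}
    {qT : T.X → Zc.X → Q.X} {qT' : T'.X → Zc.X → Q'.X} {ξ : P.X → Q.X} {ξ' : P'.X → Q'.X}
    (h : IsTripleAbsorption D ι ρ ν qQ qT ξ) (h' : IsTripleAbsorption D' ι' ρ' ν' qQ' qT' ξ')
    (hρ : IsGenEmb π T TZab ρ) {θ : T.X → T'.X} {R : TZab.X → TZba.X}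
    (hR : ∀ u S, R (TZab.ract (ρ u) S) = TZba.ract (ρ' (θ u)) S)
    {F : P.X → P'.X} (hF : IsCLMap F) (hFR : ∀ u v, F (D.lp u v) = D'.lp (R u) v)
    {M : Q.X → Q'.X} (hM : IsCLMap M) (hMθ : ∀ u v, M (qT u v) = qT' (θ u) v) (w : P.X) :
    ξ' (F w) = M (ξ w) := by
  refine (h'.isCLMap.comp hF).ext_of_dense (hM.comp h.isCLMap) D.lt.dense ?_ w
  rintro _ ⟨u, v, rfl⟩
  refine ((h'.isCLMap.comp hF).comp (D.lt.isCLMap_left v)).ext_of_dense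
    ((hM.comp h.isCLMap).comp (D.lt.isCLMap_left v)) hρ.dense ?_ u
  rintro _ ⟨u, S, rfl⟩
  rw [hFR, hR, D'.lt.balanced, h'.lp, D.lt.balanced, h.lp, hMθ]

/-- Absorption intertwines `1 ⊗ ℛθ` with `1 ⊗ θ`. -/
lemma IsTripleAbsorption.comm_right {π : A → B} {W T T' : Corr A}
    {Za Zb Zc TZab TZbc P V Q TZac TZcb P' V' Q' : Corr B}
    {mZab : Za.X → Zb.X → TZab.X} {mZbc : Zb.X → Zc.X → TZbc.X}
    {mZac : Za.X → Zc.X → TZac.X} {mZcb : Zc.X → Zb.X → TZcb.X}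
    {D : Trip Za Zb Zc TZab mZab TZbc mZbc P} {D' : Trip Za Zc Zb TZac mZac TZcb mZcb P'}
    {ι : W.X → Za.X} {ρ : T.X → TZab.X} {ρ' : T'.X → TZac.X}
    {ν : TZbc.X → V.X} {ν' : TZcb.X → V'.X} {qQ : W.X → V.X → Q.X} {qQ' : W.X → V'.X → Q'.X}
    {qT : T.X → Zc.X → Q.X} {qT' : T'.X → Zb.X → Q'.X} {ξ : P.X → Q.X} {ξ' : P'.X → Q'.X}
    (h : IsTripleAbsorption D ι ρ ν qQ qT ξ) (h' : IsTripleAbsorption D' ι ρ' ν' qQ' qT' ξ')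
    (hι : IsGenEmb π W Za ι) {R : TZbc.X → TZcb.X} {K : V.X → V'.X}
    (hR : ∀ v, ν' (R v) = K (ν v))
    {F : P.X → P'.X} (hF : IsCLMap F) (hFR : ∀ x v, F (D.rp x v) = D'.rp x (R v))
    {M : Q.X → Q'.X} (hM : IsCLMap M) (hMK : ∀ x v, M (qQ x v) = qQ' x (K v)) (w : P.X) :
    ξ' (F w) = M (ξ w) := by
  refine (h'.isCLMap.comp hF).ext_of_dense (hM.comp h.isCLMap) (hι.dense_tensor D.rt) ?_ w
  rintro _ ⟨x, v, rfl⟩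
  rw [hFR, h'.rp, h.rp, hR, hMK]

/-- Double absorption intertwines `ℛθ` with `θ ⊗ 1`. -/
lemma absorption_comm {π : A → B} {T T' : Corr A} {TZ TZ' P P' : Corr B} {ρ : T.X → TZ.X}
    {ρ' : T'.X → TZ'.X} (hρ : IsGenEmb π T TZ ρ) {q : T.X → B → P.X} {q' : T'.X → B → P'.X}
    {ν : TZ.X → P.X} {ν' : TZ'.X → P'.X} (hν : IsCLMap ν) (hν' : IsCLMap ν')
    (hq : ∀ u S, ν (TZ.ract (ρ u) S) = q u S) (hq' : ∀ u S, ν' (TZ'.ract (ρ' u) S) = q' u S)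
    {θ : T.X → T'.X} {R : TZ.X → TZ'.X} (hRc : IsCLMap R)
    (hR : ∀ u S, R (TZ.ract (ρ u) S) = TZ'.ract (ρ' (θ u)) S)
    {K : P.X → P'.X} (hK : IsCLMap K) (hKq : ∀ u S, K (q u S) = q' (θ u) S) (v : TZ.X) :
    ν' (R v) = K (ν v) := by
  refine (hν'.comp hRc).ext_of_dense (hK.comp hν) hρ.dense ?_ v
  rintro _ ⟨u, S, rfl⟩
  rw [hR, hq', hq, hKq]

/-- Lemma `M lem 2`.  With `ℰY_i = Y_i ⊗_A 𝒪(Y₁)`,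
`ℛθ_{ij} = ν_{ji}⁻¹(θ_{ij} ⊗ 1)ν_{ij}`, and the triple absorption
isomorphisms `ξ = ν_{ℓ(i⊗j)}(1 ⊗ ν_{ij})` and `ν = ν_{(j⊗ℓ)i}(ν_{jℓ} ⊗ 1)`,
one has (composites typed as maps `ℰY_ℓ ⊗ ℰY_i ⊗ ℰY_j → ℰY_j ⊗ ℰY_ℓ ⊗ ℰY_i`):
(1) `ν ∘ (ℛθ_{ℓj} ⊗ 1)(1 ⊗ ℛθ_{ij}) = (θ_{ℓj} ⊗ 1_{Y_i} ⊗ 1)(1_{Y_ℓ} ⊗ θ_{ij} ⊗ 1) ∘ ξ`;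
(2) `ν ∘ (1 ⊗ ℛθ_{iℓ})(ℛθ_{ij} ⊗ 1)(1 ⊗ ℛθ_{ℓj})(ℛθ_{ℓi} ⊗ 1)
      = ((1 ⊗ θ_{iℓ})(θ_{ij} ⊗ 1)(1 ⊗ θ_{ℓj})(θ_{ℓi} ⊗ 1) ⊗ 1_𝒪) ∘ ξ`. -/
theorem Rtheta_hexagon_identities
    {A : Type u} [NonUnitalCStarAlgebra A]
    {k : ℕ} (G : GenSys A k) (hk : 0 < k)
    (C : CPAlg (G.Y ⟨0, hk⟩)) (l i j : Fin k)
    (Z : Fin k → Corr C.O)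
    (mm : ∀ a, (G.Y a).X → C.O → (Z a).X)
    (hZ : ∀ a, ECorr G ⟨0, hk⟩ a C (Z a) (mm a))
    (TZ : Fin k → Fin k → Corr C.O)
    (mZ : ∀ a b, (Z a).X → (Z b).X → (TZ a b).X)
    (hTZ : ∀ a b, IsTensor (Z a) (Z b) (TZ a b) (mZ a b))
    (R : ∀ a b, (TZ a b).X → (TZ b a).X)
    (hR : ∀ a b, Nonempty (RTheta C.O C.π (G.Y a) (G.Y b)
      (G.T a b) (G.T b a) (G.tmul a b) (G.tmul b a) ((G.θ a b).toFun)
      (Z a) (Z b) (mm a) (mm b) (TZ a b) (TZ b a) (mZ a b) (mZ b a) (R a b)))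
    -- the "double" modules `P_{ab} = Y_a ⊗ Y_b ⊗ 𝒪 = Y_a ⊗ ℰY_b`:
    (Pij Pji Pli Plj Pjl Pil : Corr C.O)
    (pij : (G.Y i).X → (Z j).X → Pij.X) (hpij : MixedPair (G.Y i) C.π (Z j) Pij pij)
    (pji : (G.Y j).X → (Z i).X → Pji.X) (hpji : MixedPair (G.Y j) C.π (Z i) Pji pji)
    (pli : (G.Y l).X → (Z i).X → Pli.X) (hpli : MixedPair (G.Y l) C.π (Z i) Pli pli)
    (plj : (G.Y l).X → (Z j).X → Plj.X) (hplj : MixedPair (G.Y l) C.π (Z j) Plj plj)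
    (pjl : (G.Y j).X → (Z l).X → Pjl.X) (hpjl : MixedPair (G.Y j) C.π (Z l) Pjl pjl)
    (pil : (G.Y i).X → (Z l).X → Pil.X) (hpil : MixedPair (G.Y i) C.π (Z l) Pil pil)
    (qij : (G.T i j).X → C.O → Pij.X) (hqij : MixedMod (G.T i j) C.O C.π Pij qij)
    (hqijc : ∀ x y S, qij (G.tmul i j x y) S = pij x (mm j y S))
    (qji : (G.T j i).X → C.O → Pji.X) (hqji : MixedMod (G.T j i) C.O C.π Pji qji)
    (hqjic : ∀ y x S, qji (G.tmul j i y x) S = pji y (mm i x S))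
    (qli : (G.T l i).X → C.O → Pli.X) (hqli : MixedMod (G.T l i) C.O C.π Pli qli)
    (hqlic : ∀ x y S, qli (G.tmul l i x y) S = pli x (mm i y S))
    (qlj : (G.T l j).X → C.O → Plj.X) (hqlj : MixedMod (G.T l j) C.O C.π Plj qlj)
    (hqljc : ∀ x y S, qlj (G.tmul l j x y) S = plj x (mm j y S))
    (qjl : (G.T j l).X → C.O → Pjl.X) (hqjl : MixedMod (G.T j l) C.O C.π Pjl qjl)
    (hqjlc : ∀ y x S, qjl (G.tmul j l y x) S = pjl y (mm l x S))
    (qil : (G.T i l).X → C.O → Pil.X) (hqil : MixedMod (G.T i l) C.O C.π Pil qil)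
    (hqilc : ∀ x y S, qil (G.tmul i l x y) S = pil x (mm l y S))
    -- the absorption isomorphisms `ν_{ab} : ℰY_a ⊗ ℰY_b → Y_a ⊗ Y_b ⊗ 𝒪`:
    (νij : (TZ i j).X → Pij.X) (hνij : IsCLMap νij)
    (hνijc : ∀ x S ζ, νij (mZ i j (mm i x S) ζ) = pij x ((Z j).lactL S ζ))
    (νli : (TZ l i).X → Pli.X) (hνli : IsCLMap νli)
    (hνlic : ∀ x S ζ, νli (mZ l i (mm l x S) ζ) = pli x ((Z i).lactL S ζ))
    -- the flips `θ_{ab} ⊗ 1_𝒪` on the doubles: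
    (Gij : Pij.X → Pji.X) (hGij : IsCLMap Gij)
    (hGijc : ∀ u S, Gij (qij u S) = qji ((G.θ i j).toFun u) S)
    (Glj : Plj.X → Pjl.X) (hGlj : IsCLMap Glj)
    (hGljc : ∀ u S, Glj (qlj u S) = qjl ((G.θ l j).toFun u) S)
    (Gil : Pil.X → Pli.X) (hGil : IsCLMap Gil)
    (hGilc : ∀ u S, Gil (qil u S) = qli ((G.θ i l).toFun u) S)
    -- triples of `ℰY`'s:
    (P1 P2 P4 P5 P6 P7 : Corr C.O)
    (T1 : Trip (Z l) (Z i) (Z j) (TZ l i) (mZ l i) (TZ i j) (mZ i j) P1)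
    (T2 : Trip (Z l) (Z j) (Z i) (TZ l j) (mZ l j) (TZ j i) (mZ j i) P2)
    (T4 : Trip (Z j) (Z l) (Z i) (TZ j l) (mZ j l) (TZ l i) (mZ l i) P4)
    (T5 : Trip (Z i) (Z l) (Z j) (TZ i l) (mZ i l) (TZ l j) (mZ l j) P5)
    (T6 : Trip (Z i) (Z j) (Z l) (TZ i j) (mZ i j) (TZ j l) (mZ j l) P6)
    (T7 : Trip (Z j) (Z i) (Z l) (TZ j i) (mZ j i) (TZ i l) (mZ i l) P7)
    -- quadruples `Y_a ⊗ Y_b ⊗ Y_c ⊗ 𝒪` with their two relevant views: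
    (Q Q2 Q4 Q5 Q6 Q7 : Corr C.O)
    (qQ : (G.Y l).X → Pij.X → Q.X) (hqQ : MixedPair (G.Y l) C.π Pij Q qQ)
    (qTQ : (G.T l i).X → (Z j).X → Q.X) (hqTQ : MixedPair (G.T l i) C.π (Z j) Q qTQ)
    (hQc : ∀ x y ζ, qTQ (G.tmul l i x y) ζ = qQ x (pij y ζ))
    (qQ2 : (G.Y l).X → Pji.X → Q2.X) (hqQ2 : MixedPair (G.Y l) C.π Pji Q2 qQ2)
    (qT2 : (G.T l j).X → (Z i).X → Q2.X) (hqT2 : MixedPair (G.T l j) C.π (Z i) Q2 qT2)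
    (hQ2c : ∀ x y ζ, qT2 (G.tmul l j x y) ζ = qQ2 x (pji y ζ))
    (qQ4 : (G.Y j).X → Pli.X → Q4.X) (hqQ4 : MixedPair (G.Y j) C.π Pli Q4 qQ4)
    (qT4 : (G.T j l).X → (Z i).X → Q4.X) (hqT4 : MixedPair (G.T j l) C.π (Z i) Q4 qT4)
    (hQ4c : ∀ y x ζ, qT4 (G.tmul j l y x) ζ = qQ4 y (pli x ζ))
    (qQ5 : (G.Y i).X → Plj.X → Q5.X) (hqQ5 : MixedPair (G.Y i) C.π Plj Q5 qQ5)
    (qT5 : (G.T i l).X → (Z j).X → Q5.X) (hqT5 : MixedPair (G.T i l) C.π (Z j) Q5 qT5)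
    (hQ5c : ∀ x y ζ, qT5 (G.tmul i l x y) ζ = qQ5 x (plj y ζ))
    (qQ6 : (G.Y i).X → Pjl.X → Q6.X) (hqQ6 : MixedPair (G.Y i) C.π Pjl Q6 qQ6)
    (qT6 : (G.T i j).X → (Z l).X → Q6.X) (hqT6 : MixedPair (G.T i j) C.π (Z l) Q6 qT6)
    (hQ6c : ∀ x y ζ, qT6 (G.tmul i j x y) ζ = qQ6 x (pjl y ζ))
    (qQ7 : (G.Y j).X → Pil.X → Q7.X) (hqQ7 : MixedPair (G.Y j) C.π Pil Q7 qQ7)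
    (qT7 : (G.T j i).X → (Z l).X → Q7.X) (hqT7 : MixedPair (G.T j i) C.π (Z l) Q7 qT7)
    (hQ7c : ∀ y x ζ, qT7 (G.tmul j i y x) ζ = qQ7 y (pil x ζ))
    -- the triple absorption isomorphisms `ξ` and `ν`:
    (ξ : P1.X → Q.X) (hξ : IsCLMap ξ)
    (hξc : ∀ x S ζ, ξ (T1.rp (mm l x S) ζ) = qQ x (Pij.lactL S (νij ζ)))
    (ν4 : P4.X → Q4.X) (hν4 : IsCLMap ν4)
    (hν4c : ∀ y S ζ, ν4 (T4.rp (mm j y S) ζ) = qQ4 y (Pli.lactL S (νli ζ)))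
    -- the maps built from the `ℛθ`'s on the triples:
    (F1 : P1.X → P2.X) (hF1 : IsCLMap F1)
    (hF1c : ∀ ζ v, F1 (T1.rp ζ v) = T2.rp ζ (R i j v))
    (F2 : P2.X → P4.X) (hF2 : IsCLMap F2)
    (hF2c : ∀ u ζ, F2 (T2.lp u ζ) = T4.lp (R l j u) ζ)
    (G1 : P1.X → P5.X) (hG1 : IsCLMap G1)
    (hG1c : ∀ u ζ, G1 (T1.lp u ζ) = T5.lp (R l i u) ζ)
    (G2 : P5.X → P6.X) (hG2 : IsCLMap G2)
    (hG2c : ∀ ζ v, G2 (T5.rp ζ v) = T6.rp ζ (R l j v))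
    (G3 : P6.X → P7.X) (hG3 : IsCLMap G3)
    (hG3c : ∀ u ζ, G3 (T6.lp u ζ) = T7.lp (R i j u) ζ)
    (G4 : P7.X → P4.X) (hG4 : IsCLMap G4)
    (hG4c : ∀ ζ v, G4 (T7.rp ζ v) = T4.rp ζ (R i l v))
    -- the maps built from the `θ`'s on the quadruples:
    (M1 : Q.X → Q2.X) (hM1 : IsCLMap M1)
    (hM1c : ∀ x w, M1 (qQ x w) = qQ2 x (Gij w))
    (M2 : Q2.X → Q4.X) (hM2 : IsCLMap M2)
    (hM2c : ∀ u ζ, M2 (qT2 u ζ) = qT4 ((G.θ l j).toFun u) ζ)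
    (N1 : Q.X → Q5.X) (hN1 : IsCLMap N1)
    (hN1c : ∀ u ζ, N1 (qTQ u ζ) = qT5 ((G.θ l i).toFun u) ζ)
    (N2 : Q5.X → Q6.X) (hN2 : IsCLMap N2)
    (hN2c : ∀ x w, N2 (qQ5 x w) = qQ6 x (Glj w))
    (N3 : Q6.X → Q7.X) (hN3 : IsCLMap N3)
    (hN3c : ∀ u ζ, N3 (qT6 u ζ) = qT7 ((G.θ i j).toFun u) ζ)
    (N4 : Q7.X → Q4.X) (hN4 : IsCLMap N4)
    (hN4c : ∀ y w, N4 (qQ7 y w) = qQ4 y (Gil w)) :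
    -- (1):
    (∀ w : P1.X, ν4 (F2 (F1 w)) = M2 (M1 (ξ w))) ∧
    -- (2):
    ∀ w : P1.X, ν4 (G4 (G3 (G2 (G1 w)))) = N4 (N3 (N2 (N1 (ξ w)))) := by
  have hπ : IsStarHom C.π := C.isRep.hom
  choose ι hι hιr hιa hιl using fun a => (hZ a).mod.exists_isGenEmb hπ (hZ a).lact_pi
  choose ρ hρ hρm using fun a b =>
    IsGenEmb.exists_tensor hπ (G.isTensor a b) (hTZ a b) (hι a) (hι b) (hιl b)
  have hRρ : ∀ a b, IsCLMap (R a b) ∧ ∀ u S, R a b ((TZ a b).ract (ρ a b u) S) =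
      (TZ b a).ract (ρ b a ((G.θ a b).toFun u)) S := fun a b => by
    obtain ⟨D⟩ := hR a b
    exact D.isCLMap_and_apply hπ (G.isTensor a b) (G.isTensor b a) (hTZ a b) (hTZ b a)
      (hι a).isCLMap (hι b).isCLMap (hιr a) (hιr b) (hιa a) (hιa b) (hρ a b).isCLMap
      (hρ b a).isCLMap (hρm a b) (hρm b a)
  -- absorption maps on pairs
  have hνijι := absorption_apply_embedding hπ (hι i).isCLMap (hιa i) (hTZ i j) hpij hνij
    (g := fun v => v) hνijc
  have hνliι := absorption_apply_embedding hπ (hι l).isCLMap (hιa l) (hTZ l i) hpli hνli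
    (g := fun v => v) hνlic
  obtain ⟨νji, hνji, hνjiι⟩ := (hι j).exists_absorption (hTZ j i) hpji
  obtain ⟨νlj, hνlj, hνljι⟩ := (hι l).exists_absorption (hTZ l j) hplj
  obtain ⟨νjl, hνjl, hνjlι⟩ := (hι j).exists_absorption (hTZ j l) hpjl
  obtain ⟨νil, hνil, hνilι⟩ := (hι i).exists_absorption (hTZ i l) hpil
  have hνq : ∀ a b {P : Corr C.O} {p : (G.Y a).X → (Z b).X → P.X} {q : (G.T a b).X → C.O → P.X}
      {ν : (TZ a b).X → P.X}, MixedMod (G.T a b) C.O C.π P q →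
      (∀ x y S, q (G.tmul a b x y) S = p x (mm b y S)) → IsCLMap ν →
      (∀ x v, ν (mZ a b (ι a x) v) = p x v) → ∀ u S, ν ((TZ a b).ract (ρ a b u) S) = q u S :=
    fun a b _ _ _ _ hq hqc hν hνι => absorption_apply_ract hπ (G.isTensor a b) (hTZ a b) (hιr b)
      (hρ a b).isCLMap (hρm a b) hq hqc hν hνι
  have hRij : ∀ v, νji (R i j v) = Gij (νij v) :=
    absorption_comm (hρ i j) hνij hνji (hνq i j hqij hqijc hνij hνijι)
      (hνq j i hqji hqjic hνji hνjiι) (hRρ i j).1 (hRρ i j).2 hGij hGijc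
  have hRlj : ∀ v, νjl (R l j v) = Glj (νlj v) :=
    absorption_comm (hρ l j) hνlj hνjl (hνq l j hqlj hqljc hνlj hνljι)
      (hνq j l hqjl hqjlc hνjl hνjlι) (hRρ l j).1 (hRρ l j).2 hGlj hGljc
  have hRil : ∀ v, νli (R i l v) = Gil (νil v) :=
    absorption_comm (hρ i l) hνil hνli (hνq i l hqil hqilc hνil hνilι)
      (hνq l i hqli hqlic hνli hνliι) (hRρ i l).1 (hRρ i l).2 hGil hGilc
  -- absorption maps on triples
  have hξ1 : IsTripleAbsorption T1 (ι l) (ρ l i) νij qQ qTQ ξ :=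
    .of_rp hπ (G.isTensor l i) (hρ l i).isCLMap (hρm l i) hqTQ hQc hνijι hξ
      (absorption_apply_embedding hπ (hι l).isCLMap (hιa l) T1.rt hqQ hξ hξc)
  have hξ4 : IsTripleAbsorption T4 (ι j) (ρ j l) νli qQ4 qT4 ν4 :=
    .of_rp hπ (G.isTensor j l) (hρ j l).isCLMap (hρm j l) hqT4 hQ4c hνliι hν4
      (absorption_apply_embedding hπ (hι j).isCLMap (hιa j) T4.rt hqQ4 hν4 hν4c)
  obtain ⟨ξ2, hξ2⟩ := exists_isTripleAbsorption (R := T2) hπ (hι j) (hTZ j i) (hρ l j) (hρm l j)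
    hqQ2 hqT2 hQ2c hνji hνjiι
  obtain ⟨ξ5, hξ5⟩ := exists_isTripleAbsorption (R := T5) hπ (hι l) (hTZ l j) (hρ i l) (hρm i l)
    hqQ5 hqT5 hQ5c hνlj hνljι
  obtain ⟨ξ6, hξ6⟩ := exists_isTripleAbsorption (R := T6) hπ (hι j) (hTZ j l) (hρ i j) (hρm i j)
    hqQ6 hqT6 hQ6c hνjl hνjlι
  obtain ⟨ξ7, hξ7⟩ := exists_isTripleAbsorption (R := T7) hπ (hι i) (hTZ i l) (hρ j i) (hρm j i)
    hqQ7 hqT7 hQ7c hνil hνilι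
  refine ⟨fun w => ?_, fun w => ?_⟩
  · rw [hξ2.comm_left hξ4 (hρ l j) (hRρ l j).2 hF2 hF2c hM2 hM2c,
      hξ1.comm_right hξ2 (hι l) hRij hF1 hF1c hM1 hM1c]
  · rw [hξ7.comm_right hξ4 (hι j) hRil hG4 hG4c hN4 hN4c,
      hξ6.comm_left hξ7 (hρ i j) (hRρ i j).2 hG3 hG3c hN3 hN3c,
      hξ5.comm_right hξ6 (hι i) hRlj hG2 hG2c hN2 hN2c,
      hξ1.comm_left hξ5 (hρ l i) (hRρ l i).2 hG1 hG1c hN1 hN1c]
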